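/- For every g ∈ W and every α ∈ Fin n one has δ_α(Ψ(g)) = Σ_β Σ_s (−1)^s D^s( ∂_{α,s}(G_β)·Ψ(δ^W_β(g)) ); that is, as maps W → V, δ_α ∘ Ψ = Σ_β (L*)^β_α ∘ Ψ ∘ δ^W_β. (Equation (2.12) of the paper: the chain rule for variational derivatives under a weak quasi-Miura transformation, Σ_β (L*)^β_α ∘ δ/δũ_β = δ/δu_α.) -/

import Mathlib

open MvPolynomial Function

noncomputable section

/-- The algebra of differential polynomials in `n` dependent variables (`v`-coordinates):
variable `(γ, k)` is the `k`-th `x`-derivative of the `γ`-th dependent variable. -/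
abbrev V (n : ℕ) : Type := MvPolynomial (Fin n × ℕ) ℚ

/-- A second copy of the algebra of differential polynomials (`w`-coordinates).
Its total derivative `D_W` and partial derivatives `∂^W_{β,m}` are given by the same
`D` and `pderiv` as for `V`. -/
abbrev W (n : ℕ) : Type := MvPolynomial (Fin n × ℕ) ℚ

/-- The total `x`-derivative: the unique `ℚ`-linear derivation with `D (v (γ,k)) = v (γ,k+1)`. -/
def D (n : ℕ) : V n → V n :=
  ⇑(MvPolynomial.mkDerivation ℚ (fun p : Fin n × ℕ => (X (p.1, p.2 + 1) : V n)))

/-- The jet prolongation `Ψ : W →ₐ V` of a weak quasi-Miura transformation `G`,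
determined by `Ψ (w (β,m)) = D^m (G β)`. -/
def Psi (n : ℕ) (G : Fin n → V n) : W n →ₐ[ℚ] V n :=
  MvPolynomial.aeval (fun p : Fin n × ℕ => (D n)^[p.2] (G p.1))

/-- The linearization operator `L^α_β (f) = Σ_s ∂_{β,s}(G α) · D^s f`. -/
def L (n : ℕ) (G : Fin n → V n) (α β : Fin n) (f : V n) : V n :=
  ∑ᶠ s : ℕ, pderiv (β, s) (G α) * (D n)^[s] f

/-- The formal adjoint `(L*)^α_β (f) = Σ_s (−1)^s D^s (∂_{β,s}(G α) · f)`. -/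
def Lstar (n : ℕ) (G : Fin n → V n) (α β : Fin n) (f : V n) : V n :=
  ∑ᶠ s : ℕ, (-1 : V n) ^ s * (D n)^[s] (pderiv (β, s) (G α) * f)

/-- The evolutionary derivation associated to a family `a : Fin n → V n`: the unique
`ℚ`-linear derivation with `E_a (v (γ,k)) = D^k (a γ)`. -/
def Ederiv (n : ℕ) (a : Fin n → V n) : V n → V n :=
  ⇑(MvPolynomial.mkDerivation ℚ (fun p : Fin n × ℕ => (D n)^[p.2] (a p.1)))

/-- The variational derivative `δ_α f = Σ_s (−1)^s D^s (∂_{α,s} f)` (on `V` or on `W`). -/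
def vder (n : ℕ) (α : Fin n) (f : V n) : V n :=
  ∑ᶠ s : ℕ, (-1 : V n) ^ s * (D n)^[s] (pderiv (α, s) f)

theorem D_add' (n : ℕ) (a b : V n) : D n (a + b) = D n a + D n b := by
  unfold D; exact map_add _ _ _

theorem D_zero' (n : ℕ) : D n 0 = 0 := by
  unfold D; exact map_zero _

theorem D_neg' (n : ℕ) (a : V n) : D n (-a) = - D n a := by
  unfold D; exact map_neg _ _

theorem D_mul' (n : ℕ) (a b : V n) : D n (a * b) = D n a * b + a * D n b := by
  unfold D; rw [Derivation.leibniz]; simp only [smul_eq_mul]; ring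

theorem D_X' (n : ℕ) (p : Fin n × ℕ) : D n (X p) = X (p.1, p.2 + 1) := by
  unfold D; rw [mkDerivation_X]

theorem D_C' (n : ℕ) (a : ℚ) : D n (C a) = 0 := by
  unfold D; exact derivation_C _ _

theorem Dit_add (n s : ℕ) (a b : V n) : (D n)^[s] (a + b) = (D n)^[s] a + (D n)^[s] b := by
  induction s with
  | zero => rfl
  | succ s ih => simp only [iterate_succ_apply', ih, D_add']

theorem Dit_zero (n s : ℕ) : (D n)^[s] 0 = 0 := by
  induction s with
  | zero => rfl
  | succ s ih => simp only [iterate_succ_apply', ih, D_zero']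

theorem D_sgn (n s : ℕ) (a : V n) : D n ((-1) ^ s * a) = (-1) ^ s * D n a := by
  rcases neg_one_pow_eq_or (V n) s with h | h <;> simp [h, D_neg']

/-- The alternating sum of a family. -/
def AA (n : ℕ) (c : ℕ → V n) : V n := ∑ᶠ s : ℕ, (-1 : V n) ^ s * (D n)^[s] (c s)

/-- Eventually zero families. -/
def Bdd (n : ℕ) (c : ℕ → V n) : Prop := ∃ N, ∀ s, N ≤ s → c s = 0

theorem AA_eq (n : ℕ) (c : ℕ → V n) (N : ℕ) (h : ∀ s, N ≤ s → c s = 0) :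
    AA n c = ∑ s ∈ Finset.range N, (-1 : V n) ^ s * (D n)^[s] (c s) := by
  unfold AA
  apply finsum_eq_sum_of_support_subset
  intro s hs
  by_contra hn
  apply hs
  have : N ≤ s := by simpa using hn
  simp [h s this, Dit_zero]

theorem AA_add (n : ℕ) (c d : ℕ → V n) (hc : Bdd n c) (hd : Bdd n d) :
    AA n (fun s => c s + d s) = AA n c + AA n d := by
  obtain ⟨N, hN⟩ := hc
  obtain ⟨M, hM⟩ := hd
  rw [AA_eq n c (max N M) (fun s hs => hN s (le_trans (le_max_left _ _) hs)),
    AA_eq n d (max N M) (fun s hs => hM s (le_trans (le_max_right _ _) hs)),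
    AA_eq n _ (max N M) (fun s hs => by
      rw [hN s (le_trans (le_max_left _ _) hs), hM s (le_trans (le_max_right _ _) hs), add_zero]),
    ← Finset.sum_add_distrib]
  simp only [Dit_add, mul_add]

theorem D_sum' (n : ℕ) {ι : Type*} (t : Finset ι) (f : ι → V n) :
    D n (∑ i ∈ t, f i) = ∑ i ∈ t, D n (f i) := by
  unfold D; exact map_sum _ _ _

theorem AA_D (n : ℕ) (c : ℕ → V n) (hc : Bdd n c) :
    AA n (fun s => D n (c s)) = D n (AA n c) := by
  obtain ⟨N, hN⟩ := hc
  rw [AA_eq n c N hN, AA_eq n _ N (fun s hs => by rw [hN s hs, D_zero']), D_sum']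
  refine Finset.sum_congr rfl fun s _ => ?_
  rw [D_sgn, ← iterate_succ_apply, iterate_succ_apply']

theorem AA_shift (n : ℕ) (c d : ℕ → V n) (hc : Bdd n c) (h0 : d 0 = 0)
    (hs : ∀ s, d (s + 1) = c s) : AA n d = - D n (AA n c) := by
  obtain ⟨N, hN⟩ := hc
  rw [AA_eq n c N hN, AA_eq n d (N + 1) (fun s h => by
    obtain ⟨t, rfl⟩ : ∃ t, s = t + 1 := ⟨s - 1, by omega⟩
    rw [hs, hN t (by omega)]), D_sum', Finset.sum_range_succ', ← Finset.sum_neg_distrib]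
  simp only [h0, Dit_zero, mul_zero, add_zero, hs]
  refine Finset.sum_congr rfl fun s _ => ?_
  rw [D_sgn, iterate_succ_apply', pow_succ]; ring

theorem Bdd_add (n : ℕ) (c d : ℕ → V n) (hc : Bdd n c) (hd : Bdd n d) :
    Bdd n (fun s => c s + d s) := by
  obtain ⟨N, hN⟩ := hc
  obtain ⟨M, hM⟩ := hd
  exact ⟨max N M, fun s hs => by
    simp only [hN s (le_trans (le_max_left _ _) hs), hM s (le_trans (le_max_right _ _) hs),
      add_zero]⟩

theorem Bdd_pd (n : ℕ) (α : Fin n) (f : V n) : Bdd n (fun s => pderiv (α, s) f) := by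
  induction f using MvPolynomial.induction_on with
  | C a => exact ⟨0, fun s _ => by simp⟩
  | add p q hp hq => simpa only [map_add] using Bdd_add n _ _ hp hq
  | mul_X p i hp =>
    obtain ⟨N, hN⟩ := hp
    refine ⟨max N (i.2 + 1), fun s hs => ?_⟩
    have h1 : pderiv (α, s) p = 0 := hN s (le_trans (le_max_left _ _) hs)
    have h2 : i.2 + 1 ≤ s := le_trans (le_max_right _ _) hs
    have h3 : i ≠ (α, s) := by rintro rfl; simp at h2
    simp only [pderiv_mul, h1, pderiv_X_of_ne h3]
    simp

theorem Bdd_map (n : ℕ) (c : ℕ → V n) (hc : Bdd n c) (F : V n → V n) (hF : F 0 = 0) :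
    Bdd n (fun s => F (c s)) := by
  obtain ⟨N, hN⟩ := hc
  exact ⟨N, fun s hs => by simp only [hN s hs, hF]⟩

theorem pd_D (n : ℕ) (α : Fin n) (s : ℕ) (f : V n) :
    pderiv (α, s) (D n f) = D n (pderiv (α, s) f)
      + (match s with | 0 => 0 | t + 1 => pderiv (α, t) f) := by
  induction f using MvPolynomial.induction_on with
  | C a => cases s <;> simp [D_C', D_zero']
  | add p q hp hq =>
    simp only [map_add, D_add', hp, hq]
    cases s <;> simp <;> ring
  | mul_X p i hp =>
    obtain ⟨i, k⟩ := i
    have hX : pderiv (α, s) (D n (X (i, k) : V n)) = D n (pderiv (α, s) (X (i, k) : V n))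
      + (match s with | 0 => 0 | t + 1 => pderiv (α, t) (X (i, k) : V n)) := by
      have h1 : D n 1 = 0 := by simpa using D_C' n 1
      rw [D_X']
      cases s <;> simp only [pderiv_X, Pi.single_apply, Prod.mk.injEq] <;>
        split_ifs <;> simp_all [D_zero']
    simp only [pderiv_mul, D_mul', map_add, D_add', hp, hX]
    cases s <;> simp only [] <;> ring

/-- Twisted variational derivative. -/
def TT (n : ℕ) (α : Fin n) (f h : V n) : V n := AA n (fun s => pderiv (α, s) f * h)

theorem TT_bdd (n : ℕ) (α : Fin n) (f h : V n) : Bdd n (fun s => pderiv (α, s) f * h) :=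
  Bdd_map n _ (Bdd_pd n α f) (fun x => x * h) (zero_mul h)

theorem AA_zero (n : ℕ) : AA n (fun _ => 0) = 0 := by
  rw [AA_eq n _ 0 (fun _ _ => rfl)]; simp

theorem TT_D (n : ℕ) (α : Fin n) (f h : V n) : TT n α (D n f) h = - TT n α f (D n h) := by
  have e1 : TT n α (D n f) h = AA n (fun s => D n (pderiv (α, s) f) * h)
      + AA n (fun s => (match s with | 0 => 0 | t + 1 => pderiv (α, t) f) * h) := by
    rw [← AA_add]
    · simp only [TT, pd_D, add_mul]
    · exact Bdd_map n _ (Bdd_pd n α f) (fun x => D n x * h) (by simp [D_zero'])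
    · obtain ⟨N, hN⟩ := Bdd_pd n α f
      refine ⟨N + 1, fun s hs => ?_⟩
      obtain ⟨t, rfl⟩ : ∃ t, s = t + 1 := ⟨s - 1, by omega⟩
      have := hN t (by omega)
      simp_all
  have e2 : AA n (fun s => (match s with | 0 => 0 | t + 1 => pderiv (α, t) f) * h)
      = - D n (TT n α f h) :=
    AA_shift n _ _ (TT_bdd n α f h) (by simp) (fun s => rfl)
  have e3 : D n (TT n α f h) = AA n (fun s => D n (pderiv (α, s) f) * h) + TT n α f (D n h) := by
    unfold TT
    rw [← AA_D _ _ (TT_bdd n α f h), ← AA_add]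
    · simp only [D_mul']
    · exact Bdd_map n _ (Bdd_pd n α f) (fun x => D n x * h) (by simp [D_zero'])
    · exact TT_bdd n α f _
  rw [e1, e2, e3]; ring

theorem TT_add_left (n : ℕ) (α : Fin n) (f g h : V n) :
    TT n α (f + g) h = TT n α f h + TT n α g h := by
  unfold TT
  rw [← AA_add _ _ _ (TT_bdd n α f h) (TT_bdd n α g h)]
  simp only [map_add, add_mul]

theorem TT_add_right (n : ℕ) (α : Fin n) (f g h : V n) :
    TT n α f (g + h) = TT n α f g + TT n α f h := by
  unfold TT
  rw [← AA_add _ _ _ (TT_bdd n α f g) (TT_bdd n α f h)]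
  simp only [mul_add]

theorem TT_zero_right (n : ℕ) (α : Fin n) (f : V n) : TT n α f 0 = 0 := by
  unfold TT; simp only [mul_zero]; exact AA_zero n

theorem TT_C (n : ℕ) (α : Fin n) (a : ℚ) (h : V n) : TT n α (C a) h = 0 := by
  unfold TT; simp only [pderiv_C, zero_mul]; exact AA_zero n

theorem TT_neg_right (n : ℕ) (α : Fin n) (f h : V n) : TT n α f (-h) = - TT n α f h := by
  have := TT_add_right n α f (-h) h
  rw [neg_add_cancel, TT_zero_right] at this
  exact eq_neg_of_add_eq_zero_left this.symm

theorem TT_sgn_right (n : ℕ) (α : Fin n) (f h : V n) (m : ℕ) :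
    TT n α f ((-1) ^ m * h) = (-1) ^ m * TT n α f h := by
  rcases neg_one_pow_eq_or (V n) m with e | e <;> simp [e, TT_neg_right]

theorem TT_Dit (n : ℕ) (α : Fin n) (f : V n) (m : ℕ) : ∀ h : V n,
    TT n α ((D n)^[m] f) h = (-1) ^ m * TT n α f ((D n)^[m] h) := by
  induction m with
  | zero => simp
  | succ m ih =>
    intro h
    rw [iterate_succ_apply', TT_D, ih, ← iterate_succ_apply, pow_succ]; ring

theorem TT_mul (n : ℕ) (α : Fin n) (f g h : V n) :
    TT n α (f * g) h = TT n α f (g * h) + TT n α g (f * h) := by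
  unfold TT
  rw [← AA_add _ _ _ (TT_bdd n α f _) (TT_bdd n α g _)]
  congr 1; funext s; rw [pderiv_mul]; ring

theorem Psi_D (n : ℕ) (G : Fin n → V n) (g : W n) : Psi n G (D n g) = D n (Psi n G g) := by
  induction g using MvPolynomial.induction_on with
  | C a =>
    rw [D_C', map_zero]
    have : Psi n G (C a) = C a := by simp [Psi, MvPolynomial.algebraMap_eq]
    rw [this, D_C']
  | add p q hp hq => simp only [map_add, D_add', hp, hq]
  | mul_X p i hp =>
    have hX : Psi n G (D n (X i)) = D n (Psi n G (X i)) := by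
      rw [D_X']; simp only [Psi, aeval_X, iterate_succ_apply']
    simp only [D_mul', map_add, map_mul, hp, hX]

theorem Psi_Dit (n : ℕ) (G : Fin n → V n) (m : ℕ) (g : W n) :
    Psi n G ((D n)^[m] g) = (D n)^[m] (Psi n G g) := by
  induction m with
  | zero => rfl
  | succ m ih => simp only [iterate_succ_apply', Psi_D, ih]

/-- Pulled back twisted variational derivative. -/
def SS (n : ℕ) (G : Fin n → V n) (β : Fin n) (g : W n) (h : V n) : V n :=
  AA n (fun m => Psi n G (pderiv (β, m) g) * h)

theorem SS_bdd (n : ℕ) (G : Fin n → V n) (β : Fin n) (g : W n) (h : V n) :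
    Bdd n (fun m => Psi n G (pderiv (β, m) g) * h) :=
  Bdd_map n _ (Bdd_pd n β g) (fun x => Psi n G x * h) (by simp)

theorem SS_add (n : ℕ) (G : Fin n → V n) (β : Fin n) (f g : W n) (h : V n) :
    SS n G β (f + g) h = SS n G β f h + SS n G β g h := by
  unfold SS
  rw [← AA_add _ _ _ (SS_bdd n G β f h) (SS_bdd n G β g h)]
  simp only [map_add, add_mul]

theorem SS_mul (n : ℕ) (G : Fin n → V n) (β : Fin n) (f g : W n) (h : V n) :
    SS n G β (f * g) h = SS n G β f (Psi n G g * h) + SS n G β g (Psi n G f * h) := by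
  unfold SS
  rw [← AA_add _ _ _ (SS_bdd n G β f _) (SS_bdd n G β g _)]
  congr 1; funext s; rw [pderiv_mul, map_add, map_mul, map_mul]; ring

theorem SS_C (n : ℕ) (G : Fin n → V n) (β : Fin n) (a : ℚ) (h : V n) :
    SS n G β (C a) h = 0 := by
  unfold SS; simp only [pderiv_C, map_zero, zero_mul]; exact AA_zero n

theorem SS_X (n : ℕ) (G : Fin n → V n) (β : Fin n) (i : Fin n × ℕ) (h : V n) :
    SS n G β (X i) h = if β = i.1 then (-1) ^ i.2 * (D n)^[i.2] h else 0 := by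
  obtain ⟨i, k⟩ := i
  unfold SS AA
  split_ifs with e
  · simp only at e
    subst e
    rw [finsum_eq_single _ k]
    · simp
    · intro m hm
      beta_reduce
      rw [pderiv_X_of_ne (by simpa using Ne.symm hm)]
      simp [Dit_zero]
  · rw [← finsum_zero (α := ℕ)]
    congr 1; funext m
    beta_reduce
    rw [pderiv_X_of_ne (by simp; intro h; exact absurd h.symm e)]
    simp [Dit_zero]

theorem SS_one (n : ℕ) (G : Fin n → V n) (β : Fin n) (g : W n) :
    SS n G β g 1 = Psi n G (vder n β g) := by
  obtain ⟨N, hN⟩ := Bdd_pd n β g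
  have : vder n β g = AA n (fun s => pderiv (β, s) g) := rfl
  rw [this, AA_eq n _ N hN, SS, AA_eq n _ N (fun s hs => by
    have : pderiv (β, s) g = 0 := hN s hs
    simp [this]), map_sum]
  simp [Psi_Dit]

theorem TT_Psi (n : ℕ) (G : Fin n → V n) (α : Fin n) (g : W n) : ∀ h : V n,
    TT n α (Psi n G g) h = ∑ β, TT n α (G β) (SS n G β g h) := by
  induction g using MvPolynomial.induction_on with
  | C a =>
    intro h
    have : Psi n G (C a) = C a := by simp [Psi, MvPolynomial.algebraMap_eq]
    simp [this, TT_C, SS_C, TT_zero_right]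
  | add p q hp hq =>
    intro h
    simp only [map_add, TT_add_left, SS_add, TT_add_right, hp, hq, Finset.sum_add_distrib]
  | mul_X p i hp =>
    intro h
    have hX : ∀ h : V n, TT n α (Psi n G (X i)) h = ∑ β, TT n α (G β) (SS n G β (X i) h) := by
      intro h
      rw [Finset.sum_eq_single i.1]
      · rw [SS_X, if_pos rfl, TT_sgn_right, ← TT_Dit]
        simp [Psi]
      · intro β _ hb
        rw [SS_X, if_neg hb, TT_zero_right]
      · simp
    simp only [map_mul, TT_mul, SS_mul, TT_add_right, hp, hX, Finset.sum_add_distrib]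

/-- Equation (2.12) of the paper: the chain rule for variational derivatives under a weak
quasi-Miura transformation, `δ_α ∘ Ψ = Σ_β (L*)^β_α ∘ Ψ ∘ δ^W_β`. -/
theorem stmt5 (n : ℕ) (hn : 1 ≤ n) (G : Fin n → V n) (g : W n) (α : Fin n) :
    vder n α (Psi n G g)
      = ∑ᶠ β : Fin n, Lstar n G β α (Psi n G (vder n β g)) := by
  have h := TT_Psi n G α g 1
  have e : vder n α (Psi n G g) = TT n α (Psi n G g) 1 := by
    unfold vder TT AA; simp only [mul_one]
  rw [e, h, finsum_eq_sum_of_fintype]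
  refine Finset.sum_congr rfl fun β _ => ?_
  rw [SS_one]; rfl

end
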